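/- Let K ≥ 1, α ∈ (0,1), and a₁, …, a_K > 0. Let S₁, …, S_K be independent real random variables with S_k Gamma(2,a_k)-distributed, let M = max_{1≤k≤K} S_k, and let Y be uniformly distributed on [1-α², 1] and independent of (S₁,…,S_K). Then E[log(1 + M·Y)] = (1/α²)·∑_{k=1}^{K} a_k²·∫₀^∞ Υ^{ZF}(x)·x·e^{-a_k·x}·∏_{j≠k} γ(2, a_j·x) dx. (This is the ergodic rate of the first user selected by the Max-Gain User Selection scheme in multi-user mode with zero-forcing beamforming, with a_k = σ²/g_k.) -/

import Mathlib

open MeasureTheory Real Set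
open scoped ENNReal

/-- The Gamma(2, a) law: density `a² · x · e^{-a·x}` on `(0, ∞)` (shape 2, rate `a`). -/
noncomputable def gammaLaw (a : ℝ) : Measure ℝ :=
  volume.withDensity fun x =>
    ENNReal.ofReal (if 0 < x then a ^ 2 * x * Real.exp (-(a * x)) else 0)

/-- The uniform law on the real interval `[lo, hi]`. -/
noncomputable def unifLaw (lo hi : ℝ) : Measure ℝ :=
  (ENNReal.ofReal (hi - lo))⁻¹ • volume.restrict (Set.Icc lo hi)

/-- The lower incomplete gamma function with shape 2: `γ(2, z) = 1 - (z+1)·e^{-z}`. -/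
noncomputable def lGamma2 (z : ℝ) : ℝ := 1 - (z + 1) * Real.exp (-z)

/-- `Υ^{ZF}(x)` for orthogonality parameter `α`. -/
noncomputable def UpsZF (α x : ℝ) : ℝ :=
  (1 / x) * ((1 + x) * Real.log (1 + x)
    - (1 + (1 - α ^ 2) * x) * Real.log (1 + (1 - α ^ 2) * x)) - α ^ 2

open ProbabilityTheory

lemma lGamma2_nonneg (z : ℝ) : 0 ≤ lGamma2 z := by
  have h : (z + 1) * Real.exp (-z) ≤ Real.exp z * Real.exp (-z) := by
    gcongr
    exact Real.add_one_le_exp z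
  rw [← Real.exp_add, add_neg_cancel, Real.exp_zero] at h
  unfold lGamma2
  linarith

lemma lGamma2_le_one {z : ℝ} (hz : 0 ≤ z) : lGamma2 z ≤ 1 := by
  have : 0 ≤ (z + 1) * Real.exp (-z) := by positivity
  unfold lGamma2
  linarith

lemma lGamma2_zero : lGamma2 0 = 0 := by simp [lGamma2]

@[fun_prop]
lemma continuous_lGamma2 : Continuous lGamma2 := by
  unfold lGamma2
  fun_prop

lemma hasDerivAt_lGamma2_mul (a x : ℝ) :
    HasDerivAt (fun x => lGamma2 (a * x)) (a ^ 2 * x * Real.exp (-(a * x))) x := by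
  have h : HasDerivAt (fun x => a * x) a x := by simpa using (hasDerivAt_id x).const_mul a
  exact (((h.add_const 1).fun_mul h.fun_neg.exp).const_sub 1).congr_deriv (by ring)

/-- The distribution function of a law on `(0, ∞)` whose continuous density `f` has the
antiderivative `F` vanishing at `0`. -/
lemma withDensity_Iic_of_hasDerivAt {F f : ℝ → ℝ} (hF : ∀ x, HasDerivAt F (f x) x)
    (hf : Continuous f) (hf0 : ∀ x, 0 < x → 0 ≤ f x) (hF0 : F 0 = 0) (t : ℝ) :
    (volume.withDensity fun x => ENNReal.ofReal (if 0 < x then f x else 0)) (Iic t)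
      = ENNReal.ofReal (F (max t 0)) := by
  have hind : (fun x => ENNReal.ofReal (if 0 < x then f x else 0))
      = (Ioi (0 : ℝ)).indicator fun x => ENNReal.ofReal (f x) := by
    ext x
    by_cases hx : 0 < x <;> simp [hx]
  have hset : Ioi 0 ∩ Iic t = Ioc 0 (max t 0) := by
    ext x
    simp only [mem_inter_iff, mem_Ioi, mem_Iic, mem_Ioc, le_max_iff]
    grind
  rw [withDensity_apply _ measurableSet_Iic, hind, setLIntegral_indicator measurableSet_Ioi, hset,
    ← ofReal_integral_eq_lintegral_ofReal,
    ← intervalIntegral.integral_of_le (le_max_right t 0),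
    intervalIntegral.integral_eq_sub_of_hasDerivAt (fun x _ => hF x)
      (hf.intervalIntegrable _ _), hF0, sub_zero]
  · exact (hf.integrableOn_Icc).mono_set Ioc_subset_Icc_self
  · filter_upwards [ae_restrict_mem measurableSet_Ioc] with x hx using hf0 x hx.1

lemma gammaLaw_eq_gammaMeasure (a : ℝ) : gammaLaw a = gammaMeasure 2 a := by
  unfold gammaLaw gammaMeasure gammaPDF gammaPDFReal
  congr with x
  rcases lt_trichotomy x 0 with hx | rfl | hx
  · simp [hx.not_ge, hx.not_gt]
  · norm_num
  · norm_num [hx, hx.le]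

lemma isProbabilityMeasure_gammaLaw {a : ℝ} (ha : 0 < a) : IsProbabilityMeasure (gammaLaw a) := by
  rw [gammaLaw_eq_gammaMeasure]
  exact isProbabilityMeasure_gammaMeasure two_pos ha

lemma gammaLaw_Iic (a t : ℝ) : gammaLaw a (Iic t) = ENNReal.ofReal (lGamma2 (a * max t 0)) :=
  withDensity_Iic_of_hasDerivAt (hasDerivAt_lGamma2_mul a) (by fun_prop)
    (fun x hx => by positivity) (by simp [lGamma2_zero]) t

/-- The density on `(0, ∞)` of the maximum of independent Gamma(2, `a k`) variables. -/
noncomputable def maxGammaDensity {K : ℕ} (a : Fin K → ℝ) (x : ℝ) : ℝ :=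
  ∑ k, (∏ j ∈ Finset.univ.erase k, lGamma2 (a j * x)) * (a k ^ 2 * x * Real.exp (-(a k * x)))

@[fun_prop]
lemma continuous_maxGammaDensity {K : ℕ} (a : Fin K → ℝ) : Continuous (maxGammaDensity a) := by
  unfold maxGammaDensity
  fun_prop

lemma maxGammaDensity_nonneg {K : ℕ} (a : Fin K → ℝ) {x : ℝ} (hx : 0 < x) :
    0 ≤ maxGammaDensity a x :=
  Finset.sum_nonneg fun k _ => mul_nonneg
    (Finset.prod_nonneg fun j _ => lGamma2_nonneg _) (by positivity)

lemma map_iSup_pi_gammaLaw {K : ℕ} (hK : 1 ≤ K) {a : Fin K → ℝ} (ha : ∀ k, 0 < a k) :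
    Measure.map (fun s : Fin K → ℝ => ⨆ k, s k) (Measure.pi fun k => gammaLaw (a k))
      = volume.withDensity fun x => ENNReal.ofReal (if 0 < x then maxGammaDensity a x else 0) := by
  have : NeZero K := ⟨by omega⟩
  have := fun k => isProbabilityMeasure_gammaLaw (ha k)
  have hsup : Measurable fun s : Fin K → ℝ => ⨆ k, s k := .iSup fun k => measurable_pi_apply k
  have := Measure.isProbabilityMeasure_map (μ := Measure.pi fun k => gammaLaw (a k))
    hsup.aemeasurable
  refine Measure.ext_of_Iic _ _ fun t => ?_
  have hpre : (fun s : Fin K → ℝ => ⨆ k, s k) ⁻¹' Iic t = univ.pi fun _ => Iic t := by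
    ext s
    simp only [mem_preimage, mem_Iic, ciSup_le_iff (finite_range s).bddAbove, mem_univ_pi]
  rw [Measure.map_apply hsup measurableSet_Iic, hpre, Measure.pi_pi,
    withDensity_Iic_of_hasDerivAt (F := fun x => ∏ k, lGamma2 (a k * x)) _
      (continuous_maxGammaDensity a) (fun x => maxGammaDensity_nonneg a)
      (by simp [lGamma2_zero]; omega) t,
    ENNReal.ofReal_prod_of_nonneg
      fun k _ => lGamma2_nonneg _]
  · simp only [gammaLaw_Iic]
  · intro x
    simpa only [smul_eq_mul, maxGammaDensity] using
      HasDerivAt.fun_finsetProd fun k (_ : k ∈ Finset.univ) => hasDerivAt_lGamma2_mul (a k) x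

lemma integral_log_one_add_mul_eq_UpsZF {α x : ℝ} (hα : α ∈ Ioo (0 : ℝ) 1) (hx : 0 < x) :
    ∫ y in (1 - α ^ 2)..1, Real.log (1 + x * y) = UpsZF α x := by
  have hα1 : 0 ≤ 1 - α ^ 2 := by nlinarith [hα.1, hα.2]
  have hpos : ∀ y ∈ uIcc (1 - α ^ 2) 1, 0 < 1 + x * y := by
    intro y hy
    rw [uIcc_of_le (by nlinarith [hα.1])] at hy
    nlinarith [hy.1, mul_nonneg hx.le (hα1.trans hy.1)]
  rw [intervalIntegral.integral_eq_sub_of_hasDerivAt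
    (f := fun y => (1 / x) * ((1 + x * y) * Real.log (1 + x * y)) - y)]
  · unfold UpsZF
    ring_nf
  · intro y hy
    have h : HasDerivAt (fun y => 1 + x * y) x y := by
      simpa using ((hasDerivAt_id y).const_mul x).const_add 1
    have hy0 := (hpos y hy).ne'
    convert ((h.fun_mul (h.log hy0)).const_mul (1 / x)).fun_sub (hasDerivAt_id' y) using 1
    field_simp
    ring
  · exact ContinuousOn.intervalIntegrable
      (ContinuousOn.log (by fun_prop) fun y hy => (hpos y hy).ne')

lemma UpsZF_nonneg {α x : ℝ} (hα : α ∈ Ioo (0 : ℝ) 1) (hx : 0 < x) : 0 ≤ UpsZF α x := by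
  rw [← integral_log_one_add_mul_eq_UpsZF hα hx]
  refine intervalIntegral.integral_nonneg (by nlinarith [hα.1]) fun y hy => Real.log_nonneg ?_
  have : 0 ≤ y := by nlinarith [hα.1, hα.2, hy.1]
  nlinarith [mul_nonneg hx.le this]

lemma UpsZF_le {α x : ℝ} (hα : α ∈ Ioo (0 : ℝ) 1) (hx : 0 < x) : UpsZF α x ≤ x := by
  have hα1 : 0 ≤ 1 - α ^ 2 := by nlinarith [hα.1, hα.2]
  have h := intervalIntegral.norm_integral_le_of_norm_le_const (a := 1 - α ^ 2) (b := 1) (C := x)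
    (f := fun y => Real.log (1 + x * y)) fun y hy => by
      rw [uIoc_of_le (by nlinarith [hα.1])] at hy
      have h0 : 0 ≤ x * y := mul_nonneg hx.le (hα1.trans hy.1.le)
      rw [Real.norm_of_nonneg (Real.log_nonneg (by linarith))]
      have := Real.log_le_sub_one_of_pos (show 0 < 1 + x * y by linarith)
      nlinarith [hy.2]
  rw [integral_log_one_add_mul_eq_UpsZF hα hx, Real.norm_of_nonneg (UpsZF_nonneg hα hx),
    sub_sub_cancel, abs_of_nonneg (sq_nonneg α)] at h
  nlinarith [hα.1, hα.2]

@[fun_prop]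
lemma measurable_UpsZF (α : ℝ) : Measurable (UpsZF α) := by
  unfold UpsZF
  fun_prop

lemma integrableOn_UpsZF_mul {K : ℕ} {α : ℝ} (hα : α ∈ Ioo (0 : ℝ) 1) {a : Fin K → ℝ}
    (ha : ∀ k, 0 < a k) (k : Fin K) :
    IntegrableOn (fun x => UpsZF α x * x * Real.exp (-(a k * x)) *
      ∏ j ∈ Finset.univ.erase k, lGamma2 (a j * x)) (Ioi 0) := by
  have hdom := integrableOn_rpow_mul_exp_neg_mul_rpow (p := 1) (s := 2) (by norm_num)
    one_pos (ha k)
  refine Integrable.mono' hdom (by fun_prop) ?_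
  filter_upwards [ae_restrict_mem measurableSet_Ioi] with x (hx : 0 < x)
  have hl : ∀ j ∈ Finset.univ.erase k, 0 ≤ lGamma2 (a j * x) :=
    fun j _ => lGamma2_nonneg _
  have hp : ∏ j ∈ Finset.univ.erase k, lGamma2 (a j * x) ≤ 1 :=
    Finset.prod_le_one hl fun j _ => lGamma2_le_one (mul_pos (ha j) hx).le
  have hp0 := Finset.prod_nonneg hl
  have hU := UpsZF_nonneg hα hx
  rw [Real.norm_of_nonneg (by positivity)]
  calc _ ≤ x * x * Real.exp (-(a k * x)) * 1 := by
        gcongr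
        exact UpsZF_le hα hx
    _ = _ := by simp; ring

lemma lintegral_unifLaw_log {α x : ℝ} (hα : α ∈ Ioo (0 : ℝ) 1) (hx : 0 < x) :
    ∫⁻ y, ENNReal.ofReal (Real.log (1 + x * y)) ∂unifLaw (1 - α ^ 2) 1
      = ENNReal.ofReal (1 / α ^ 2 * UpsZF α x) := by
  have hα1 : 0 ≤ 1 - α ^ 2 := by nlinarith [hα.1, hα.2]
  have hα2 : 0 < α ^ 2 := pow_pos hα.1 2
  have hpos : ∀ y ∈ Icc (1 - α ^ 2) 1, 1 ≤ 1 + x * y :=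
    fun y hy => by nlinarith [mul_nonneg hx.le (hα1.trans hy.1)]
  rw [unifLaw, lintegral_smul_measure, ← ofReal_integral_eq_lintegral_ofReal,
    integral_Icc_eq_integral_Ioc, ← intervalIntegral.integral_of_le (by linarith),
    integral_log_one_add_mul_eq_UpsZF hα hx, sub_sub_cancel, smul_eq_mul,
    ← ENNReal.ofReal_inv_of_pos hα2, ← ENNReal.ofReal_mul (by positivity), one_div]
  · refine ContinuousOn.integrableOn_Icc (ContinuousOn.log (by fun_prop) fun y hy => ?_)
    linarith [hpos y hy]
  · filter_upwards [ae_restrict_mem measurableSet_Icc] with y hy using Real.log_nonneg (hpos y hy)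

lemma integral_log_maxGamma_prod_unifLaw {K : ℕ} {α : ℝ} (hα : α ∈ Ioo (0 : ℝ) 1)
    (a : Fin K → ℝ) :
    ∫ p, Real.log (1 + p.1 * p.2) ∂((volume.withDensity fun x =>
        ENNReal.ofReal (if 0 < x then maxGammaDensity a x else 0)).prod (unifLaw (1 - α ^ 2) 1))
      = ∫ x in Ioi (0 : ℝ), maxGammaDensity a x * (1 / α ^ 2 * UpsZF α x) := by
  have hα1 : 0 ≤ 1 - α ^ 2 := by nlinarith [hα.1, hα.2]
  have hden : Measurable fun x => ENNReal.ofReal (if 0 < x then maxGammaDensity a x else 0) :=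
    (Measurable.ite measurableSet_Ioi (by fun_prop) (by fun_prop)).ennreal_ofReal
  have : SFinite (unifLaw (1 - α ^ 2) 1) := by
    unfold unifLaw
    infer_instance
  have hX : ∀ᵐ x ∂(volume.withDensity fun x =>
      ENNReal.ofReal (if 0 < x then maxGammaDensity a x else 0)), 0 ≤ x := by
    rw [ae_withDensity_iff hden]
    refine ae_of_all _ fun x hx => ?_
    by_contra h
    exact hx (by simp [show ¬ 0 < x from fun h' => h h'.le])
  have hY : ∀ᵐ y ∂unifLaw (1 - α ^ 2) 1, 0 ≤ y := by
    refine Measure.ae_smul_measure ?_ _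
    filter_upwards [ae_restrict_mem measurableSet_Icc] with y hy using hα1.trans hy.1
  have hmeas : Measurable fun p : ℝ × ℝ => Real.log (1 + p.1 * p.2) := by fun_prop
  rw [integral_eq_lintegral_of_nonneg_ae _ hmeas.aestronglyMeasurable,
    lintegral_prod _ hmeas.ennreal_ofReal.aemeasurable,
    lintegral_withDensity_eq_lintegral_mul _ hden hmeas.ennreal_ofReal.lintegral_prod_right',
    integral_eq_lintegral_of_nonneg_ae _ (by fun_prop), ← lintegral_indicator measurableSet_Ioi]
  · congr 2 with x
    by_cases hx : 0 < x
    · simp [hx, lintegral_unifLaw_log hα hx, ENNReal.ofReal_mul (maxGammaDensity_nonneg a hx)]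
    · simp [hx]
  · filter_upwards [ae_restrict_mem measurableSet_Ioi] with x (hx : 0 < x)
    have := maxGammaDensity_nonneg a hx
    have := UpsZF_nonneg hα hx
    simp only [Pi.zero_apply]
    positivity
  · filter_upwards [Measure.quasiMeasurePreserving_fst.ae hX,
      Measure.quasiMeasurePreserving_snd.ae hY] with p h1 h2
    exact Real.log_nonneg (by nlinarith [mul_nonneg h1 h2])

/-- Ergodic rate of the first user selected by the MUS scheme in
multi-user mode with zero-forcing beamforming: `S₁, …, S_K` independent with
`S_k ~ Gamma(2, a_k)`, `M = max_k S_k`, `Y ~ Uniform[1-α², 1]` independent of the `S_k`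
(joint law the product of the marginals). Then
`E[log(1 + M·Y)]
  = (1/α²)·∑_k a_k²·∫₀^∞ Υ^{ZF}(x)·x·e^{-a_k·x}·∏_{j≠k} γ(2, a_j·x) dx`. -/
theorem mus_mu_mode_zf_first_user_rate {Ω : Type*} [MeasurableSpace Ω]
    (μ : Measure Ω) [IsProbabilityMeasure μ]
    (K : ℕ) (hK : 1 ≤ K) (α : ℝ) (hα : α ∈ Set.Ioo (0 : ℝ) 1)
    (a : Fin K → ℝ) (ha : ∀ k, 0 < a k)
    (S : Fin K → Ω → ℝ) (Y : Ω → ℝ)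
    (hSmeas : ∀ k, Measurable (S k)) (hYmeas : Measurable Y)
    (hlaw : Measure.map (fun ω => ((fun k => S k ω, Y ω) : (Fin K → ℝ) × ℝ)) μ
      = (Measure.pi fun k => gammaLaw (a k)).prod (unifLaw (1 - α ^ 2) 1)) :
    ∫ ω, Real.log (1 + (⨆ k, S k ω) * Y ω) ∂μ
      = (1 / α ^ 2) * ∑ k : Fin K, (a k) ^ 2 *
          ∫ x in Set.Ioi (0 : ℝ),
            UpsZF α x * x * Real.exp (-(a k * x)) *
              ∏ j ∈ Finset.univ.erase k, lGamma2 (a j * x) := by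
  have := fun k => isProbabilityMeasure_gammaLaw (ha k)
  have : SFinite (unifLaw (1 - α ^ 2) 1) := by
    unfold unifLaw
    infer_instance
  have hsup : Measurable fun s : Fin K → ℝ => ⨆ k, s k := .iSup fun k => measurable_pi_apply k
  have hmap : Measure.map (fun ω => (⨆ k, S k ω, Y ω)) μ
      = (volume.withDensity fun x =>
          ENNReal.ofReal (if 0 < x then maxGammaDensity a x else 0)).prod
            (unifLaw (1 - α ^ 2) 1) := by
    rw [← map_iSup_pi_gammaLaw hK ha, ← Measure.map_id (μ := unifLaw (1 - α ^ 2) 1), Measure.map_prod_map _ _ hsup measurable_id, ← hlaw,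
      Measure.map_map (hsup.prodMap measurable_id) (by fun_prop)]
    rfl
  have hpair : Measurable fun ω => (⨆ k, S k ω, Y ω) := (Measurable.iSup hSmeas).prodMk hYmeas
  have hmeas : Measurable fun p : ℝ × ℝ => Real.log (1 + p.1 * p.2) := by fun_prop
  rw [← integral_map (φ := fun ω => (⨆ k, S k ω, Y ω)) hpair.aemeasurable
    hmeas.aestronglyMeasurable, hmap, integral_log_maxGamma_prod_unifLaw hα a]
  simp_rw [← integral_const_mul]
  rw [← integral_finsetSum _ fun k _ => (integrableOn_UpsZF_mul hα ha k).const_mul _,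
    ← integral_const_mul]
  congr 1 with x
  rw [maxGammaDensity, Finset.sum_mul, Finset.mul_sum]
  exact Finset.sum_congr rfl fun k _ => by ring
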